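/- arXiv:2005.10079 — 3 statements merged into one kernel-verified Lean document; each statement's English description precedes it below -/
import Mathlib

section
/- Let α ∈ (0,1) and k > 0. Then the improper integral ∫_0^∞ t^{−α} e^{−i k t} dt, understood as the limit as T → ∞ of ∫_0^T t^{−α} e^{−i k t} dt, converges and equals Γ(1−α) · (i k)^{α−1}, where (i k)^{α−1} is the principal-branch complex power and Γ is the real Gamma function. -/
open MeasureTheory

noncomputable def rgF (α : ℝ) (z : ℂ) (t : ℝ) : ℂ :=
  ((t ^ (-α) : ℝ) : ℂ) * Complex.exp (-(z * (t : ℂ)))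

lemma rgF_meas (α : ℝ) (z : ℂ) : Measurable (rgF α z) := by
  unfold rgF
  fun_prop

lemma rgF_norm (α : ℝ) (z : ℂ) {t : ℝ} (ht : 0 < t) :
    ‖rgF α z t‖ = t ^ (-α) * Real.exp (-(z.re * t)) := by
  unfold rgF
  rw [norm_mul, Complex.norm_exp, Complex.norm_real, Real.norm_of_nonneg (by positivity)]
  simp

lemma rg_int_real {s b : ℝ} (hs : -1 < s) (hb : 0 < b) :
    IntegrableOn (fun t : ℝ => t ^ s * Real.exp (-(b * t))) (Set.Ioi 0) := by
  have := integrableOn_rpow_mul_exp_neg_mul_rpow hs one_pos hb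
  simpa using this

lemma rgF_int {α : ℝ} (hα : α < 1) {z : ℂ} (hz : 0 < z.re) :
    IntegrableOn (rgF α z) (Set.Ioi 0) := by
  refine Integrable.mono' (rg_int_real (s := -α) (by linarith) hz)
    (rgF_meas α z).aestronglyMeasurable ?_
  filter_upwards [ae_restrict_mem measurableSet_Ioi] with t ht
  exact (rgF_norm α z ht).le

lemma rgF_diff {α : ℝ} (hα : α < 1) {z : ℂ} (hz : 0 < z.re) :
    DifferentiableAt ℂ (fun z => ∫ t in Set.Ioi (0:ℝ), rgF α z t) z := by
  have hs : {w : ℂ | z.re / 2 < w.re} ∈ nhds z :=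
    (isOpen_lt continuous_const Complex.continuous_re).mem_nhds (by simp; linarith)
  refine (hasDerivAt_integral_of_dominated_loc_of_deriv_le
    (F' := fun w t => -(t:ℂ) * rgF α w t)
    (bound := fun t => t ^ (1 - α) * Real.exp (-(z.re / 2 * t))) hs
    (Filter.Eventually.of_forall fun w => (rgF_meas α w).aestronglyMeasurable)
    (rgF_int hα hz) ?_ ?_ (rg_int_real (by linarith) (by linarith)) ?_).2.differentiableAt
  · have := rgF_meas α z
    exact Measurable.aestronglyMeasurable (by fun_prop)
  · filter_upwards [ae_restrict_mem measurableSet_Ioi] with t ht w hw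
    have ht' : 0 < t := ht
    have hw' : z.re / 2 < w.re := hw
    rw [norm_mul, rgF_norm α w ht, norm_neg, Complex.norm_real, Real.norm_of_nonneg ht'.le,
      ← mul_assoc, show 1 - α = 1 + -α by ring, Real.rpow_add ht', Real.rpow_one]
    gcongr
  · refine Filter.Eventually.of_forall fun t w _ => ?_
    have h := (((hasDerivAt_id w).mul_const (t:ℂ)).neg.cexp).const_mul ((t ^ (-α) : ℝ) : ℂ)
    unfold rgF
    convert! h using 1
    simp
    ring

lemma rgF_integral {α : ℝ} (hα : α < 1) {z : ℂ} (hz : 0 < z.re) :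
    ∫ t in Set.Ioi (0:ℝ), rgF α z t = (Real.Gamma (1 - α) : ℂ) * z ^ ((α : ℂ) - 1) := by
  have hopen : IsOpen {w : ℂ | 0 < w.re} := isOpen_lt continuous_const Complex.continuous_re
  have h1 : AnalyticOnNhd ℂ (fun z => ∫ t in Set.Ioi (0:ℝ), rgF α z t) {w : ℂ | 0 < w.re} :=
    DifferentiableOn.analyticOnNhd
      (fun w hw => (rgF_diff hα hw).differentiableWithinAt) hopen
  have h2 : AnalyticOnNhd ℂ (fun z : ℂ => (Real.Gamma (1 - α) : ℂ) * z ^ ((α : ℂ) - 1))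
      {w : ℂ | 0 < w.re} := by
    refine DifferentiableOn.analyticOnNhd (fun w hw => ?_) hopen
    refine DifferentiableAt.differentiableWithinAt ?_
    exact (differentiableAt_id.cpow_const (Or.inl hw)).const_mul _
  have hU : IsPreconnected {w : ℂ | 0 < w.re} := (convex_halfSpace_re_gt 0).isPreconnected
  refine h1.eqOn_of_preconnected_of_frequently_eq h2 hU (z₀ := 1) (by simp) ?_ hz
  have hreal : ∀ r : ℝ, 0 < r → ∫ t in Set.Ioi (0:ℝ), rgF α (r:ℂ) t
      = (Real.Gamma (1 - α) : ℂ) * (r:ℂ) ^ ((α : ℂ) - 1) := by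
    intro r hr
    have h := Real.integral_rpow_mul_exp_neg_mul_Ioi (a := 1 - α) (by linarith) hr
    have h' : ∫ t in Set.Ioi (0:ℝ), rgF α (r:ℂ) t =
        ((∫ t in Set.Ioi (0:ℝ), t ^ (1 - α - 1) * Real.exp (-(r * t)) : ℝ) : ℂ) := by
      rw [← integral_complex_ofReal]
      refine integral_congr_ae (Filter.Eventually.of_forall fun t => ?_)
      simp only [rgF]
      push_cast
      rw [show 1 - α - 1 = -α by ring]
    rw [h', h, one_div, Real.inv_rpow hr.le, ← Real.rpow_neg hr.le, Complex.ofReal_mul,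
      Complex.ofReal_cpow hr.le, mul_comm]
    congr 2
    push_cast
    ring
  have ht : Filter.Tendsto (fun r : ℝ => (r : ℂ)) (nhdsWithin 1 (Set.Ioi 1))
      (nhdsWithin (1:ℂ) {1}ᶜ) := by
    refine tendsto_nhdsWithin_iff.2 ⟨?_, ?_⟩
    · exact (Complex.continuous_ofReal.tendsto' 1 1 (by simp)).mono_left nhdsWithin_le_nhds
    · filter_upwards [self_mem_nhdsWithin] with r hr
      simp only [Set.mem_compl_iff, Set.mem_singleton_iff, Complex.ofReal_eq_one]
      exact (ne_of_gt hr)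
  refine ht.frequently (Filter.Eventually.frequently ?_)
  filter_upwards [self_mem_nhdsWithin] with r hr
  exact hreal r (lt_trans one_pos hr)

lemma rgF_tail {α : ℝ} (hα : 0 < α) {z : ℂ} (hz : 0 < z.re) {T S : ℝ} (hT : 0 < T)
    (hTS : T ≤ S) : ‖∫ t in T..S, rgF α z t‖ ≤ 2 * T ^ (-α) / ‖z‖ := by
  have hz0 : z ≠ 0 := by rintro rfl; simp at hz
  have hzn : 0 < ‖z‖ := norm_pos_iff.2 hz0
  have hS : 0 < S := hT.trans_le hTS
  have hpos : ∀ x ∈ Set.uIcc T S, 0 < x := fun x hx => by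
    rw [Set.uIcc_of_le hTS] at hx; exact hT.trans_le hx.1
  have hcr : ContinuousOn (fun t : ℝ => -α * t ^ (-α - 1)) (Set.uIcc T S) := by
    refine continuousOn_const.mul (continuousOn_id.rpow_const fun x hx => Or.inl (hpos x hx).ne')
  have hdr : ∀ x ∈ Set.uIcc T S, HasDerivAt (fun t : ℝ => t ^ (-α)) (-α * x ^ (-α - 1)) x :=
    fun x hx => Real.hasDerivAt_rpow_const (Or.inl (hpos x hx).ne')
  have hint : ∫ t in T..S, -α * t ^ (-α - 1) = S ^ (-α) - T ^ (-α) :=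
    intervalIntegral.integral_eq_sub_of_hasDerivAt hdr hcr.intervalIntegrable
  have hexp : ∀ x : ℝ, 0 < x → ‖Complex.exp (-(z * (x:ℂ))) * (-1 / z)‖ ≤ 1 / ‖z‖ := by
    intro x hx
    rw [norm_mul, Complex.norm_exp, norm_div, norm_neg, norm_one]
    have : Real.exp (-(z * (x:ℂ))).re ≤ 1 := by
      rw [Real.exp_le_one_iff]
      simp
      positivity
    exact mul_le_of_le_one_left (by positivity) this
  have hparts := intervalIntegral.integral_mul_deriv_eq_deriv_mul (a := T) (b := S)
    (u := fun t : ℝ => ((t ^ (-α) : ℝ) : ℂ)) (u' := fun t : ℝ => ((-α * t ^ (-α - 1) : ℝ) : ℂ))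
    (v := fun t : ℝ => Complex.exp (-(z * (t:ℂ))) * (-1 / z))
    (v' := fun t : ℝ => Complex.exp (-(z * (t:ℂ))))
    (fun x hx => (hdr x hx).ofReal_comp)
    (fun x _ => by
      have h := ((((hasDerivAt_id x).ofReal_comp).const_mul z).neg.cexp).mul_const (-1 / z)
      convert! h using 1
      simp
      field_simp)
    (Complex.continuous_ofReal.comp_continuousOn hcr).intervalIntegrable
    (Continuous.intervalIntegrable (by fun_prop) _ _)
  have hb : ‖∫ t in T..S, ((-α * t ^ (-α - 1) : ℝ) : ℂ) *
      (Complex.exp (-(z * (t:ℂ))) * (-1 / z))‖ ≤ ∫ t in T..S, (-α * t ^ (-α - 1)) * (-1 / ‖z‖) := by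
    refine intervalIntegral.norm_integral_le_of_norm_le hTS ?_
      (hcr.intervalIntegrable.mul_const _)
    refine Filter.Eventually.of_forall fun t ht => ?_
    have ht0 : 0 < t := hT.trans ht.1
    rw [norm_mul, Complex.norm_real, norm_mul, norm_neg, Real.norm_of_nonneg hα.le,
      Real.norm_of_nonneg (by positivity : 0 ≤ t ^ (-α - 1))]
    calc _ ≤ α * t ^ (-α - 1) * (1 / ‖z‖) := by gcongr; exact hexp t ht0
      _ = _ := by ring
  rw [intervalIntegral.integral_mul_const, hint] at hb
  have e1 : ∀ x : ℝ, 0 < x → ‖((x ^ (-α) : ℝ) : ℂ) * (Complex.exp (-(z * (x:ℂ))) * (-1 / z))‖ ≤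
      x ^ (-α) * (1 / ‖z‖) := by
    intro x hx
    rw [norm_mul, Complex.norm_real, Real.norm_of_nonneg (by positivity)]
    gcongr
    exact hexp x hx
  have : ∫ t in T..S, rgF α z t = _ := hparts
  rw [this]
  refine (norm_sub_le _ _).trans ?_
  refine (add_le_add ((norm_sub_le _ _).trans (add_le_add (e1 S hS) (e1 T hT))) hb).trans ?_
  apply le_of_eq
  ring

lemma rgF_interval {α : ℝ} (hα : α < 1) (z : ℂ) (hz : 0 ≤ z.re) {T S : ℝ} (hT : 0 ≤ T)
    (hS : 0 ≤ S) : IntervalIntegrable (rgF α z) volume T S := by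
  refine IntervalIntegrable.mono_fun
    (intervalIntegral.intervalIntegrable_rpow' (r := -α) (by linarith))
    (rgF_meas α z).aestronglyMeasurable ?_
  filter_upwards [ae_restrict_mem measurableSet_uIoc] with t ht
  have ht0 : 0 < t := (le_min hT hS).trans_lt ht.1
  rw [rgF_norm α z ht0, Real.norm_of_nonneg (by positivity)]
  refine mul_le_of_le_one_right (by positivity) ?_
  rw [Real.exp_le_one_iff]
  have := mul_nonneg hz ht0.le
  linarith

lemma rgF_trunc {α : ℝ} (h0 : 0 < α) (hα : α < 1) {z : ℂ} (hz : 0 < z.re) {T : ℝ} (hT : 0 < T) :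
    ‖(∫ t in (0:ℝ)..T, rgF α z t) - (Real.Gamma (1 - α) : ℂ) * z ^ ((α : ℂ) - 1)‖
      ≤ 2 * T ^ (-α) / ‖z‖ := by
  have hlim := intervalIntegral_tendsto_integral_Ioi 0 (rgF_int hα hz) Filter.tendsto_id
  rw [rgF_integral hα hz] at hlim
  refine le_of_tendsto (tendsto_const_nhds.sub hlim).norm ?_
  filter_upwards [Filter.eventually_ge_atTop T] with S hS
  rw [norm_sub_rev]
  simp only [id]
  rw [intervalIntegral.integral_interval_sub_left
    (rgF_interval hα z hz.le le_rfl (hT.le.trans hS)) (rgF_interval hα z hz.le le_rfl hT.le)]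
  exact rgF_tail h0 hz hT hS

lemma rgF_bound {α k : ℝ} (h0 : 0 < α) (hα : α < 1) (hk : 0 < k) {T : ℝ} (hT : 0 < T) :
    ‖(∫ t in (0:ℝ)..T, rgF α (Complex.I * k) t) -
      (Real.Gamma (1 - α) : ℂ) * (Complex.I * k) ^ ((α : ℂ) - 1)‖ ≤ 2 * T ^ (-α) / k := by
  have hz : Filter.Tendsto (fun ε : ℝ => (ε : ℂ) + Complex.I * k) (nhdsWithin 0 (Set.Ioi 0))
      (nhds (Complex.I * k)) := by
    have : Continuous (fun ε : ℝ => (ε : ℂ) + Complex.I * k) := by fun_prop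
    exact (this.tendsto' 0 _ (by simp)).mono_left nhdsWithin_le_nhds
  have hA : Filter.Tendsto (fun ε : ℝ => ∫ t in (0:ℝ)..T, rgF α ((ε : ℂ) + Complex.I * k) t)
      (nhdsWithin 0 (Set.Ioi 0)) (nhds (∫ t in (0:ℝ)..T, rgF α (Complex.I * k) t)) := by
    refine intervalIntegral.tendsto_integral_filter_of_dominated_convergence
      (fun t => t ^ (-α)) (Filter.Eventually.of_forall fun ε =>
        (rgF_meas α _).aestronglyMeasurable) ?_
      (intervalIntegral.intervalIntegrable_rpow' (by linarith)) ?_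
    · filter_upwards [self_mem_nhdsWithin] with ε hε
      refine Filter.Eventually.of_forall fun t ht => ?_
      rw [Set.uIoc_of_le hT.le] at ht
      have hε' : 0 < ε := hε
      have ht0 := ht.1
      rw [rgF_norm α _ ht.1]
      refine mul_le_of_le_one_right (by positivity) ?_
      rw [Real.exp_le_one_iff]
      simp
      positivity
    · refine Filter.Eventually.of_forall fun t _ => ?_
      have : Continuous fun z => rgF α z t := by unfold rgF; fun_prop
      exact (this.tendsto _).comp hz
  have hB : Filter.Tendsto (fun ε : ℝ => (Real.Gamma (1 - α) : ℂ) *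
      ((ε : ℂ) + Complex.I * k) ^ ((α : ℂ) - 1))
      (nhdsWithin 0 (Set.Ioi 0))
      (nhds ((Real.Gamma (1 - α) : ℂ) * (Complex.I * k) ^ ((α : ℂ) - 1))) := by
    refine Filter.Tendsto.const_mul _ ?_
    have hs : Complex.I * (k:ℂ) ∈ Complex.slitPlane := Or.inr (by simp [hk.ne'])
    exact ((continuousAt_id.cpow continuousAt_const hs).tendsto).comp hz
  refine le_of_tendsto (hA.sub hB).norm ?_
  filter_upwards [self_mem_nhdsWithin] with ε hε
  have hε' : 0 < ε := hε
  refine (rgF_trunc h0 hα (by simpa using hε') hT).trans ?_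
  gcongr
  have := Complex.abs_im_le_norm ((ε : ℂ) + Complex.I * k)
  simp only [Complex.add_im, Complex.ofReal_im, Complex.I_mul_im, Complex.ofReal_re, zero_add] at this
  exact (le_abs_self k).trans this

/-- The rotated Gamma integral: `∫_0^∞ t^{-α} e^{-ikt} dt = Γ(1-α) (ik)^{α-1}`
as an improper (conditionally convergent) integral. -/
theorem rotated_gamma_integral
    (α k : ℝ) (hα : α ∈ Set.Ioo (0 : ℝ) 1) (hk : 0 < k) :
    Filter.Tendsto
      (fun T : ℝ => ∫ t in (0 : ℝ)..T, ((t ^ (-α) : ℝ) : ℂ) * Complex.exp (-(Complex.I) * ((k : ℂ) * (t : ℂ))))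
      Filter.atTop
      (nhds ((Real.Gamma (1 - α) : ℂ) * (Complex.I * (k : ℂ)) ^ ((α : ℂ) - 1))) := by
  have hfun : ∀ t : ℝ, ((t ^ (-α) : ℝ) : ℂ) * Complex.exp (-(Complex.I) * ((k : ℂ) * (t : ℂ)))
      = rgF α (Complex.I * k) t := by
    intro t
    unfold rgF
    congr 2
    ring
  simp_rw [hfun]
  rw [tendsto_iff_norm_sub_tendsto_zero]
  have hlim : Filter.Tendsto (fun T : ℝ => 2 * T ^ (-α) / k) Filter.atTop (nhds 0) := by
    have := ((tendsto_rpow_neg_atTop hα.1).const_mul 2).div_const k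
    simpa using this
  refine squeeze_zero' (Filter.Eventually.of_forall fun _ => norm_nonneg _) ?_ hlim
  filter_upwards [Filter.eventually_gt_atTop 0] with T hT
  exact rgF_bound hα.1 hα.2 hk hT
end

section
/- Let E, ρ > 0, ρ′ ≥ 0, l ≥ 0, k > 0, and α₁, α₂ ∈ [1/2, 1]. Define the complex number Z² = (E/ρ) · ( −i^{2α₁} · k^{2(α₁−1)} + i^{2(α₁+α₂)} · k^{2(α₁+α₂−1)} · l²/4 ) · (1 + ρ′ l² k² / (3ρ))^{−2}, where i^{β} denotes the principal-branch complex power of the imaginary unit. Then Im(Z²) ≤ 0. -/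
theorem I_cpow_two_mul_real (a : ℝ) :
    Complex.I ^ ((2 * a : ℝ) : ℂ)
      = ((Real.cos (Real.pi * a) : ℝ) : ℂ) + ((Real.sin (Real.pi * a) : ℝ) : ℂ) * Complex.I := by
  rw [Complex.cpow_def_of_ne_zero Complex.I_ne_zero, Complex.log_I, Complex.ofReal_cos,
    Complex.ofReal_sin, ← Complex.exp_mul_I]
  congr 1
  push_cast
  ring

/-- The squared complex phase velocity `Z²` of longitudinal waves in the
fractional-order 1D continuum has nonpositive imaginary part for
`α₁, α₂ ∈ [1/2, 1]` (stability/causality of the dispersion relation). -/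
theorem squared_phase_velocity_im_nonpos
    (E ρ ρ' l k α₁ α₂ : ℝ) (hE : 0 < E) (hρ : 0 < ρ) (hρ' : 0 ≤ ρ')
    (hl : 0 ≤ l) (hk : 0 < k)
    (h1 : α₁ ∈ Set.Icc (1 / 2 : ℝ) 1) (h2 : α₂ ∈ Set.Icc (1 / 2 : ℝ) 1) :
    (((E / ρ : ℝ) : ℂ) *
      (-(Complex.I ^ ((2 * α₁ : ℝ) : ℂ)) * ((k ^ (2 * (α₁ - 1)) : ℝ) : ℂ)
        + Complex.I ^ ((2 * (α₁ + α₂) : ℝ) : ℂ) * ((k ^ (2 * (α₁ + α₂ - 1)) : ℝ) : ℂ)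
          * ((l ^ 2 : ℝ) : ℂ) / 4) *
      ((((1 + ρ' * l ^ 2 * k ^ 2 / (3 * ρ) : ℝ) : ℂ)) ^ 2)⁻¹).im ≤ 0 := by
  obtain ⟨h1a, h1b⟩ := h1
  obtain ⟨h2a, h2b⟩ := h2
  have hpi := Real.pi_pos
  have s1 : 0 ≤ Real.sin (Real.pi * α₁) :=
    Real.sin_nonneg_of_nonneg_of_le_pi (by nlinarith) (by nlinarith)
  have s2 : Real.sin (Real.pi * (α₁ + α₂)) ≤ 0 := by
    rw [← Real.sin_sub_two_pi]
    exact Real.sin_nonpos_of_nonpos_of_neg_pi_le (by nlinarith) (by nlinarith)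
  rw [I_cpow_two_mul_real, I_cpow_two_mul_real]
  have hA : 0 ≤ k ^ (2 * (α₁ - 1)) := Real.rpow_nonneg hk.le _
  have hB : 0 ≤ k ^ (2 * (α₁ + α₂ - 1)) := Real.rpow_nonneg hk.le _
  generalize k ^ (2 * (α₁ - 1)) = A at *
  generalize k ^ (2 * (α₁ + α₂ - 1)) = B at *
  generalize 1 + ρ' * l ^ 2 * k ^ 2 / (3 * ρ) = D at *
  generalize Real.sin (Real.pi * α₁) = u at *
  generalize Real.sin (Real.pi * (α₁ + α₂)) = v at *
  generalize Real.cos (Real.pi * α₁) = c at *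
  generalize Real.cos (Real.pi * (α₁ + α₂)) = d at *
  have hF : 0 ≤ E / ρ := by positivity
  generalize E / ρ = F at *
  have key : ((F : ℂ) * (-((c : ℂ) + (u : ℂ) * Complex.I) * (A : ℂ)
        + ((d : ℂ) + (v : ℂ) * Complex.I) * (B : ℂ) * ((l ^ 2 : ℝ) : ℂ) / 4) * ((D : ℂ) ^ 2)⁻¹)
      = ((F * (-c * A + d * B * l ^ 2 / 4) * (D ^ 2)⁻¹ : ℝ) : ℂ)
        + ((F * (-u * A + v * B * l ^ 2 / 4) * (D ^ 2)⁻¹ : ℝ) : ℂ) * Complex.I := by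
    push_cast
    ring
  rw [key, Complex.add_im, Complex.ofReal_im, Complex.im_ofReal_mul, Complex.I_im, zero_add, mul_one]
  have e1 : 0 ≤ u * A := mul_nonneg s1 hA
  have e2 : v * B * l ^ 2 ≤ 0 :=
    mul_nonpos_of_nonpos_of_nonneg (mul_nonpos_of_nonpos_of_nonneg s2 hB) (sq_nonneg l)
  exact mul_nonpos_of_nonpos_of_nonneg
    (mul_nonpos_of_nonneg_of_nonpos hF (by linarith)) (by positivity)
end

section
/- Let α ∈ (0,1), L_B > 0, x ∈ ℝ, and let ψ be a continuously differentiable real function on a neighborhood of [x − δ, x + L_B] for some δ > 0. Then lim_{L_A → 0⁺} D^α ψ(x) = (1/2) [ ψ′(x) + (1−α) L_B^{α−1} ∫_{x}^{x+L_B} (s−x)^{−α} ψ′(s) ds ], where D^α ψ(x) is the Riesz–Caputo fractional derivative of order α with length scales L_A, L_B. -/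
open MeasureTheory

lemma kernel_integrable (α x L : ℝ) (h1 : α < 1) :
    IntervalIntegrable (fun s : ℝ => (x - s) ^ (-α)) volume (x - L) x := by
  have h : IntervalIntegrable (fun u : ℝ => u ^ (-α)) volume L 0 :=
    intervalIntegral.intervalIntegrable_rpow' (by linarith)
  have := h.comp_sub_left x
  simpa using this

lemma kernel_integral (α x L : ℝ) (h1 : α < 1) :
    ∫ s in (x - L)..x, (x - s) ^ (-α) = L ^ (1 - α) / (1 - α) := by
  rw [intervalIntegral.integral_comp_sub_left (fun u : ℝ => u ^ (-α)) x]
  rw [integral_rpow (Or.inl (by linarith))]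
  rw [sub_self, sub_sub_cancel, Real.zero_rpow (by linarith)]
  rw [sub_zero, neg_add_eq_sub]

lemma left_limit (α x δ : ℝ) (h1 : α < 1) (hδ : 0 < δ) (f : ℝ → ℝ)
    (hf : ContinuousOn f (Set.Icc (x - δ) x)) :
    Filter.Tendsto (fun L : ℝ => L ^ (α - 1) * ∫ s in (x - L)..x, (x - s) ^ (-α) * f s)
      (nhdsWithin 0 (Set.Ioi 0)) (nhds (f x / (1 - α))) := by
  have ha : 0 < 1 - α := by linarith
  rw [Metric.tendsto_nhdsWithin_nhds]
  intro ε hε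
  obtain ⟨η, hη, hc⟩ := Metric.continuousWithinAt_iff.1
    (hf x ⟨by linarith, le_refl x⟩) (ε * (1 - α) / 2) (by positivity)
  refine ⟨min η δ, lt_min hη hδ, ?_⟩
  intro L hL hd
  have hL : 0 < L := hL
  rw [Real.dist_eq, sub_zero, abs_of_pos hL] at hd
  have hLη : L < η := lt_of_lt_of_le hd (min_le_left _ _)
  have hLδ : L < δ := lt_of_lt_of_le hd (min_le_right _ _)
  have hle : x - L ≤ x := by linarith
  have hk := kernel_integrable α x L h1
  have hkf : IntervalIntegrable (fun s => (x - s) ^ (-α) * f s) volume (x - L) x := by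
    apply hk.mul_continuousOn
    rw [Set.uIcc_of_le hle]
    exact hf.mono (Set.Icc_subset_Icc (by linarith) le_rfl)
  have hp : L ^ (α - 1) * L ^ (1 - α) = 1 := by
    rw [← Real.rpow_add hL]; simp
  have hfx : f x / (1 - α) = L ^ (α - 1) * ∫ s in (x - L)..x, (x - s) ^ (-α) * f x := by
    rw [intervalIntegral.integral_mul_const, kernel_integral α x L h1]
    linear_combination (-(f x / (1 - α))) * hp
  rw [Real.dist_eq, hfx, ← mul_sub, ← intervalIntegral.integral_sub hkf (hk.mul_const _),
    abs_mul, abs_of_pos (Real.rpow_pos_of_pos hL _)]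
  have hb : |∫ s in (x - L)..x, ((x - s) ^ (-α) * f s - (x - s) ^ (-α) * f x)|
      ≤ ∫ s in (x - L)..x, (x - s) ^ (-α) * (ε * (1 - α) / 2) := by
    rw [← Real.norm_eq_abs]
    apply intervalIntegral.norm_integral_le_of_norm_le hle _ (hk.mul_const _)
    refine Filter.Eventually.of_forall fun s hs => ?_
    have h0 : 0 ≤ (x - s) ^ (-α) := Real.rpow_nonneg (by linarith [hs.2]) _
    rw [← mul_sub, Real.norm_eq_abs, abs_mul, abs_of_nonneg h0]
    apply mul_le_mul_of_nonneg_left _ h0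
    have := hc (x := s) ⟨by linarith [hs.1], hs.2⟩
      (by rw [Real.dist_eq, abs_lt]; constructor <;> linarith [hs.1, hs.2])
    rw [Real.dist_eq] at this
    exact this.le
  rw [intervalIntegral.integral_mul_const, kernel_integral α x L h1] at hb
  calc _ ≤ L ^ (α - 1) * (L ^ (1 - α) / (1 - α) * (ε * (1 - α) / 2)) :=
        mul_le_mul_of_nonneg_left hb (Real.rpow_nonneg hL.le _)
    _ = (L ^ (α - 1) * L ^ (1 - α)) * (ε / 2) := by field_simp
    _ < ε := by rw [hp]; linarith

/-- Boundary-completeness (Eq. S13): as the left horizon `L_A → 0⁺`, the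
Riesz–Caputo fractional derivative of order `α` with length scales `L_A, L_B`
reduces to half the classical derivative plus the right-sided nonlocal convolution. -/
theorem rieszCaputo_boundary_limit
    (α LB x δ : ℝ) (hα : α ∈ Set.Ioo (0 : ℝ) 1) (hLB : 0 < LB) (hδ : 0 < δ)
    (ψ : ℝ → ℝ) (U : Set ℝ) (hU : IsOpen U) (hsub : Set.Icc (x - δ) (x + LB) ⊆ U)
    (hψ : ContDiffOn ℝ 1 ψ U) :
    Filter.Tendsto
      (fun LA : ℝ => ((1 - α) / 2) *
        (LA ^ (α - 1) * (∫ s in (x - LA)..x, (x - s) ^ (-α) * deriv ψ s)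
          + LB ^ (α - 1) * ∫ s in x..(x + LB), (s - x) ^ (-α) * deriv ψ s))
      (nhdsWithin 0 (Set.Ioi 0))
      (nhds ((1 / 2) * (deriv ψ x
        + (1 - α) * LB ^ (α - 1) * ∫ s in x..(x + LB), (s - x) ^ (-α) * deriv ψ s))) := by
  have h1 : α < 1 := hα.2
  have ha : (1 - α) ≠ 0 := by linarith
  have hf : ContinuousOn (deriv ψ) (Set.Icc (x - δ) x) :=
    (hψ.continuousOn_deriv_of_isOpen hU le_rfl).mono
      ((Set.Icc_subset_Icc le_rfl (by linarith)).trans hsub)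
  have h := ((left_limit α x δ h1 hδ _ hf).add_const
    (LB ^ (α - 1) * ∫ s in x..(x + LB), (s - x) ^ (-α) * deriv ψ s)).const_mul ((1 - α) / 2)
  convert h using 2
  field_simp
end
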